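/- Let q > 1/2. For every real y ≠ 0, the derivative of the Cauchy transform of the Student t-distribution at the purely imaginary point iy is the positive real number G̃'_{t_q}(iy) = (2q−1)·∫_ℝ x²/(x²+y²) dt_{q+1}(x); in particular G̃'_{t_q}(iy) ∈ (0,∞) ⊂ ℝ. -/

import Mathlib

open MeasureTheory Complex Set

/-- The Cauchy transform `∫ 1/(z-x) dμ(x)` of a measure on ℝ. -/
noncomputable def cauchyT (μ : Measure ℝ) (z : ℂ) : ℂ := ∫ x, (z - (x : ℂ))⁻¹ ∂μ

/-- The Euler beta function `B(p,q) = ∫₀¹ x^(p-1) (1-x)^(q-1) dx`. -/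
noncomputable def betaFun (p q : ℝ) : ℝ := ∫ x in Ioo (0:ℝ) 1, x ^ (p - 1) * (1 - x) ^ (q - 1)

/-- The Student t-distribution `t_q` on ℝ, with density `(1+x²)^(-q)/B(1/2, q-1/2)`. -/
noncomputable def tMeasure (q : ℝ) : Measure ℝ :=
  volume.withDensity fun x =>
    ENNReal.ofReal ((1 + x ^ 2) ^ (-q) / betaFun (1/2) (q - 1/2))

theorem betaFun_eq_beta {a b : ℝ} (ha : 0 < a) (hb : 0 < b) :
    betaFun a b = ProbabilityTheory.beta a b := by
  rw [ProbabilityTheory.beta_eq_betaIntegralReal a b ha hb, betaFun, Complex.betaIntegral,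
    intervalIntegral.integral_of_le zero_le_one, integral_Ioc_eq_integral_Ioo]
  have h : ∀ x ∈ Ioo (0 : ℝ) 1, (x : ℂ) ^ ((a : ℂ) - 1) * (1 - (x : ℂ)) ^ ((b : ℂ) - 1) =
      ((x ^ (a - 1) * (1 - x) ^ (b - 1) : ℝ) : ℂ) := by
    intro x hx
    push_cast [Complex.ofReal_cpow hx.1.le, Complex.ofReal_cpow (sub_pos.2 hx.2).le]
    rfl
  rw [setIntegral_congr_fun measurableSet_Ioo h, integral_complex_ofReal, ofReal_re]

theorem betaFun_pos {a b : ℝ} (ha : 0 < a) (hb : 0 < b) : 0 < betaFun a b := by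
  rw [betaFun_eq_beta ha hb]
  exact ProbabilityTheory.beta_pos ha hb

theorem betaFun_add_one {a b : ℝ} (ha : 0 < a) (hb : 0 < b) :
    (a + b) * betaFun a (b + 1) = b * betaFun a b := by
  rw [betaFun_eq_beta ha hb, betaFun_eq_beta ha (by positivity), ProbabilityTheory.beta,
    ProbabilityTheory.beta, ← add_assoc, Real.Gamma_add_one hb.ne',
    Real.Gamma_add_one (by positivity)]
  have := (Real.Gamma_pos_of_pos (add_pos ha hb)).ne'
  field_simp

theorem integrable_one_add_sq_rpow_neg {q : ℝ} (hq : 1 / 2 < q) :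
    Integrable fun x : ℝ => (1 + x ^ 2) ^ (-q) := by
  have h := integrable_rpow_neg_one_add_norm_sq (E := ℝ) (μ := volume) (r := 2 * q)
    (by simp; linarith)
  refine h.congr (Filter.Eventually.of_forall fun x => ?_)
  simp only [Real.norm_eq_abs, sq_abs]
  congr 1
  ring

theorem isFiniteMeasure_tMeasure {q : ℝ} (hq : 1 / 2 < q) : IsFiniteMeasure (tMeasure q) :=
  isFiniteMeasure_withDensity_ofReal ((integrable_one_add_sq_rpow_neg hq).div_const _).2

theorem integral_tMeasure {E : Type*} [NormedAddCommGroup E] [NormedSpace ℝ E] {q : ℝ}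
    (hq : 1 / 2 < q) (f : ℝ → E) :
    ∫ x, f x ∂tMeasure q =
      (betaFun (1 / 2) (q - 1 / 2))⁻¹ • ∫ x : ℝ, (1 + x ^ 2) ^ (-q) • f x := by
  have hB : 0 < betaFun (1 / 2) (q - 1 / 2) := betaFun_pos (by norm_num) (by linarith)
  rw [tMeasure, integral_withDensity_eq_integral_toReal_smul (by fun_prop)
    (Filter.Eventually.of_forall fun _ => ENNReal.ofReal_lt_top), ← integral_smul]
  refine integral_congr_ae (Filter.Eventually.of_forall fun x => ?_)
  simp only
  rw [ENNReal.toReal_ofReal (by positivity), smul_smul, div_eq_inv_mul]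

theorem sub_ofReal_ne_zero {z : ℂ} (hz : z.im ≠ 0) (x : ℝ) : z - x ≠ 0 := fun h =>
  hz (by simpa using congrArg Complex.im h)

theorem norm_inv_sub_ofReal_le {z : ℂ} (hz : z.im ≠ 0) (x : ℝ) :
    ‖(z - x)⁻¹‖ ≤ |z.im|⁻¹ := by
  rw [norm_inv]
  have h := Complex.abs_im_le_norm (z - x)
  simp only [sub_im, ofReal_im, sub_zero] at h
  exact inv_anti₀ (abs_pos.2 hz) h

theorem hasDerivAt_cauchyT (μ : Measure ℝ) [IsFiniteMeasure μ] {z : ℂ} (hz : z.im ≠ 0) :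
    HasDerivAt (cauchyT μ) (∫ x : ℝ, -((z - x)⁻¹ ^ 2) ∂μ) z := by
  have hz' : 0 < |z.im| := abs_pos.2 hz
  have hs : {w : ℂ | |z.im| / 2 < |w.im|} ∈ nhds z :=
    (isOpen_lt continuous_const (by fun_prop)).mem_nhds (half_lt_self hz')
  refine (hasDerivAt_integral_of_dominated_loc_of_deriv_le (μ := μ) (𝕜 := ℂ)
    (F := fun w x => (w - (x : ℂ))⁻¹) (F' := fun w x => -((w - (x : ℂ))⁻¹ ^ 2))
    (bound := fun _ => (|z.im| / 2)⁻¹ ^ 2) hs ?_ ?_ ?_ ?_ ?_ ?_).2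
  · exact Filter.Eventually.of_forall fun w =>
      Measurable.aestronglyMeasurable (by fun_prop)
  · exact Integrable.of_bound (Measurable.aestronglyMeasurable (by fun_prop)) _
      (Filter.Eventually.of_forall fun x => norm_inv_sub_ofReal_le hz x)
  · exact Measurable.aestronglyMeasurable (by fun_prop)
  · refine Filter.Eventually.of_forall fun x w hw => ?_
    have hw : |z.im| / 2 < |w.im| := hw
    rw [norm_neg, norm_pow]
    gcongr
    refine (norm_inv_sub_ofReal_le (abs_pos.1 (by linarith)) x).trans ?_
    gcongr
  · exact integrable_const _
  · refine Filter.Eventually.of_forall fun x w hw => ?_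
    have hw : |z.im| / 2 < |w.im| := hw
    have hne := sub_ofReal_ne_zero (abs_pos.1 (by linarith : 0 < |w.im|)) x
    refine (((hasDerivAt_id w).sub_const (x : ℂ)).fun_inv hne).congr_deriv ?_
    simp [neg_div]

theorem hasDerivAt_one_add_sq_rpow_neg (q x : ℝ) :
    HasDerivAt (fun x : ℝ => (1 + x ^ 2) ^ (-q)) (-2 * q * (x * (1 + x ^ 2) ^ (-(q + 1)))) x := by
  have h : HasDerivAt (fun x : ℝ => 1 + x ^ 2) (2 * x) x := by
    simpa using (hasDerivAt_pow 2 x).const_add 1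
  refine (h.rpow_const (p := -q) (Or.inl (by positivity))).congr_deriv ?_
  rw [neg_add, ← sub_eq_add_neg]
  ring

theorem integrable_mul_one_add_sq_rpow_neg {q : ℝ} (hq : 1 / 2 < q) :
    Integrable fun x : ℝ => x * (1 + x ^ 2) ^ (-(q + 1)) := by
  refine (integrable_one_add_sq_rpow_neg hq).mono'
    (Measurable.aestronglyMeasurable (by fun_prop)) (Filter.Eventually.of_forall fun x => ?_)
  have h1 : (0 : ℝ) < 1 + x ^ 2 := by positivity
  have h2 : (1 + x ^ 2) ^ (-q) = (1 + x ^ 2) * (1 + x ^ 2) ^ (-(q + 1)) := by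
    rw [← Real.rpow_one_add' h1.le (by linarith)]
    ring_nf
  rw [h2, norm_mul, Real.norm_eq_abs, Real.norm_of_nonneg (by positivity)]
  gcongr
  nlinarith [sq_nonneg (|x| - 1), sq_abs x]

theorem integrable_inv_sub_mul {z : ℂ} (hz : z.im ≠ 0) {f : ℝ → ℝ} (hf : Integrable f) :
    Integrable fun x : ℝ => (z - x)⁻¹ * (f x : ℂ) :=
  hf.ofReal.bdd_mul (Measurable.aestronglyMeasurable (by fun_prop))
    (Filter.Eventually.of_forall fun x => norm_inv_sub_ofReal_le hz x)

theorem integral_rpow_smul_neg_inv_sq {q : ℝ} (hq : 1 / 2 < q) {z : ℂ} (hz : z.im ≠ 0) :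
    ∫ x : ℝ, (1 + x ^ 2) ^ (-q) • -((z - x)⁻¹ ^ 2) =
      -2 * q * ∫ x : ℝ, (z - x)⁻¹ * ((x * (1 + x ^ 2) ^ (-(q + 1)) : ℝ) : ℂ) := by
  have hu : ∀ x : ℝ, HasDerivAt (fun x : ℝ => (z - x)⁻¹) ((z - x)⁻¹ ^ 2) x := fun x => by
    refine (((Complex.ofRealCLM.hasDerivAt (x := x)).const_sub z).fun_inv
      (sub_ofReal_ne_zero hz x)).congr_deriv ?_
    simp
  have hint := integrable_inv_sub_mul hz (integrable_one_add_sq_rpow_neg hq)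
  have h := integral_mul_deriv_eq_deriv_mul_of_integrable
    (u := fun x : ℝ => (z - x)⁻¹) (u' := fun x : ℝ => (z - x)⁻¹ ^ 2)
    (v := fun x : ℝ => (((1 + x ^ 2) ^ (-q) : ℝ) : ℂ))
    (v' := fun x : ℝ => ((-2 * q * (x * (1 + x ^ 2) ^ (-(q + 1))) : ℝ) : ℂ))
    (fun x _ => hu x) (fun x _ => (hasDerivAt_one_add_sq_rpow_neg q x).ofReal_comp)
    (integrable_inv_sub_mul hz ((integrable_mul_one_add_sq_rpow_neg hq).const_mul _))
    ?_ hint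
  · rw [← integral_const_mul]
    calc _ = -∫ x : ℝ, (z - x)⁻¹ ^ 2 * (((1 + x ^ 2) ^ (-q) : ℝ) : ℂ) := by
          rw [← integral_neg]
          congr 1 with x
          rw [Complex.real_smul]
          ring
      _ = _ := by
          rw [← h]
          congr 1 with x
          push_cast
          ring
  · refine (hint.bdd_mul (f := fun x : ℝ => (z - x)⁻¹)
      (Measurable.aestronglyMeasurable (by fun_prop))
      (Filter.Eventually.of_forall fun x => norm_inv_sub_ofReal_le hz x)).congr
      (Filter.Eventually.of_forall fun x => ?_)
    simp only [Pi.mul_apply]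
    ring

theorem integral_inv_mul_I_sub_mul {q : ℝ} (hq : 1 / 2 < q) {y : ℝ} (hy : y ≠ 0) :
    ∫ x : ℝ, (y * I - x)⁻¹ * ((x * (1 + x ^ 2) ^ (-(q + 1)) : ℝ) : ℂ) =
      -((∫ x : ℝ, (1 + x ^ 2) ^ (-(q + 1)) • (x ^ 2 / (x ^ 2 + y ^ 2)) : ℝ) : ℂ) := by
  have hz : ((y : ℂ) * I).im ≠ 0 := by simpa using hy
  set g : ℝ → ℂ := fun x => (y * I - x)⁻¹ * ((x * (1 + x ^ 2) ^ (-(q + 1)) : ℝ) : ℂ) with hg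
  have hgi : Integrable g := integrable_inv_sub_mul hz (integrable_mul_one_add_sq_rpow_neg hq)
  have hsum : ∀ x, g x + g (-x) =
      -2 * (((1 + x ^ 2) ^ (-(q + 1)) • (x ^ 2 / (x ^ 2 + y ^ 2)) : ℝ) : ℂ) := by
    intro x
    have h1 := sub_ofReal_ne_zero hz x
    have h2 := sub_ofReal_ne_zero hz (-x)
    have h3 : ((x : ℂ) ^ 2 + (y : ℂ) ^ 2) ≠ 0 := by
      norm_cast
      positivity
    simp only [hg, neg_sq, smul_eq_mul]
    push_cast at h2 ⊢
    field_simp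
    linear_combination
      (2 * (x : ℂ) ^ 2 * y ^ 2 * (((1 + x ^ 2) ^ (-(q + 1)) : ℝ) : ℂ)) * Complex.I_sq
  have h := integral_add hgi hgi.comp_neg
  rw [integral_neg_eq_self g, integral_congr_ae (Filter.Eventually.of_forall hsum),
    integral_const_mul, integral_complex_ofReal] at h
  linear_combination -h / 2

theorem integral_sq_div_tMeasure_pos {q : ℝ} (hq : 1 / 2 < q) {y : ℝ} (hy : y ≠ 0) :
    0 < ∫ x, x ^ 2 / (x ^ 2 + y ^ 2) ∂tMeasure q := by
  rw [integral_tMeasure hq]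
  have hB : 0 < betaFun (1 / 2) (q - 1 / 2) := betaFun_pos (by norm_num) (by linarith)
  refine smul_pos (inv_pos.2 hB) ?_
  have hc : Continuous fun x : ℝ => (1 + x ^ 2) ^ (-q) • (x ^ 2 / (x ^ 2 + y ^ 2)) := by
    have h1 : Continuous fun x : ℝ => (1 + x ^ 2) ^ (-q) :=
      Continuous.rpow_const (by fun_prop) fun x => Or.inl (by positivity)
    have h2 : Continuous fun x : ℝ => x ^ 2 / (x ^ 2 + y ^ 2) :=
      Continuous.div (by fun_prop) (by fun_prop) fun x => by positivity
    exact h1.smul h2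
  refine integral_pos_of_integrable_nonneg_nonzero hc (x := 1) ?_ (fun x => by positivity)
    (by positivity)
  refine (integrable_one_add_sq_rpow_neg hq).mono' hc.aestronglyMeasurable
    (Filter.Eventually.of_forall fun x => ?_)
  rw [Real.norm_of_nonneg (by positivity), smul_eq_mul]
  refine mul_le_of_le_one_right (by positivity) (div_le_one_of_le₀ ?_ (by positivity))
  nlinarith [sq_nonneg y]

theorem stmt_17 (q : ℝ) (hq : 1/2 < q) (y : ℝ) (hy : y ≠ 0) :
    HasDerivAt (cauchyT (tMeasure q))
      ((((2 * q - 1) * ∫ x, x ^ 2 / (x ^ 2 + y ^ 2) ∂(tMeasure (q + 1)) : ℝ)) : ℂ)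
      ((y : ℂ) * Complex.I) ∧
    0 < (2 * q - 1) * ∫ x, x ^ 2 / (x ^ 2 + y ^ 2) ∂(tMeasure (q + 1)) := by
  refine ⟨?_, mul_pos (by linarith) (integral_sq_div_tMeasure_pos (by linarith) hy)⟩
  have := isFiniteMeasure_tMeasure hq
  have hz : ((y : ℂ) * Complex.I).im ≠ 0 := by simpa using hy
  convert hasDerivAt_cauchyT (tMeasure q) hz using 1
  rw [integral_tMeasure hq, integral_rpow_smul_neg_inv_sq hq hz, integral_inv_mul_I_sub_mul hq hy,
    integral_tMeasure (by linarith), Complex.real_smul]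
  have hB : 0 < betaFun (1 / 2) (q - 1 / 2) := betaFun_pos (by norm_num) (by linarith)
  have hB' : 0 < betaFun (1 / 2) (q + 1 - 1 / 2) := betaFun_pos (by norm_num) (by linarith)
  have hrec : q * betaFun (1 / 2) (q + 1 - 1 / 2) =
      (q - 1 / 2) * betaFun (1 / 2) (q - 1 / 2) := by
    convert betaFun_add_one (a := 1 / 2) (b := q - 1 / 2) (by norm_num) (by linarith) using 2 <;>
      ring_nf
  have hconst : (2 * q - 1) * (betaFun (1 / 2) (q + 1 - 1 / 2))⁻¹ =
      2 * q * (betaFun (1 / 2) (q - 1 / 2))⁻¹ := by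
    rw [← div_eq_mul_inv, ← div_eq_mul_inv, div_eq_div_iff hB'.ne' hB.ne']
    linear_combination -2 * hrec
  rw [smul_eq_mul, ← mul_assoc, hconst]
  push_cast
  ring
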